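/- arXiv:2207.08061 — 5 statements merged into one kernel-verified Lean document; each statement's English description precedes it below -/
import Mathlib

section
/- Let V be a finite set with |V| = n ≥ 1, let T ≥ 1 be an integer, and let (G_t)_{t≥1} be a sequence of simple graphs on V such that, for every i ≥ 1, the graph on V whose edge set is the union of the edge sets of G_i, G_{i+1}, …, G_{i+T-1} is connected. Then for every p ∈ V one has R_{T(n-1)}(p) = V; in particular, information takes less than Tn rounds to travel from any process to any other process. -/
/-- Influence sets: `R 0 = {p}` and
`R (t+1) = R t ∪ {v | v is adjacent in G (t+1) to some u ∈ R t}`. -/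
def influence {V : Type*} (G : ℕ → SimpleGraph V) (p : V) : ℕ → Set V
  | 0 => {p}
  | t + 1 => influence G p t ∪ {v | ∃ u ∈ influence G p t, (G (t + 1)).Adj u v}

theorem influence_mono {V : Type*} (G : ℕ → SimpleGraph V) (p : V) :
    Monotone (influence G p) :=
  monotone_nat_of_le_succ fun _ => Set.subset_union_left

theorem mem_influence_self {V : Type*} (G : ℕ → SimpleGraph V) (p : V) (t : ℕ) :
    p ∈ influence G p t :=
  influence_mono G p (Nat.zero_le t) rfl

/-- An influence set that is not yet everything grows strictly over any window of rounds whose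
union is connected. -/
theorem influence_ssubset_add {V : Type*} {G : ℕ → SimpleGraph V} {p : V} {t T : ℕ}
    (hconn : (⨆ j ∈ Finset.range T, G (t + 1 + j)).Connected)
    (hne : influence G p t ≠ Set.univ) :
    influence G p t ⊂ influence G p (t + T) := by
  obtain ⟨w, hw⟩ := (Set.ne_univ_iff_exists_notMem _).1 hne
  obtain ⟨walk⟩ := hconn.preconnected p w
  obtain ⟨d, -, hfst, hsnd⟩ :=
    walk.exists_boundary_dart (influence G p t) (mem_influence_self G p t) hw
  have hadj := d.adj
  simp only [SimpleGraph.iSup_adj, Finset.mem_range] at hadj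
  obtain ⟨j, hj, hadj⟩ := hadj
  have hmem : d.snd ∈ influence G p (t + j + 1) := by
    refine Or.inr ⟨d.fst, influence_mono G p (Nat.le_add_right t j) hfst, ?_⟩
    rwa [Nat.add_right_comm]
  exact (Set.ssubset_iff_of_subset (influence_mono G p (Nat.le_add_right t T))).2
    ⟨d.snd, influence_mono G p (by omega) hmem, hsnd⟩

theorem influence_full_T_interval_disconnected
    {V : Type*} [Fintype V] (n : ℕ) (hn : 1 ≤ n) (hcard : Fintype.card V = n)
    (T : ℕ) (hT : 1 ≤ T) (G : ℕ → SimpleGraph V)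
    (hconn : ∀ i, 1 ≤ i → (⨆ j ∈ Finset.range T, G (i + j)).Connected) :
    ∀ p : V, influence G p (T * (n - 1)) = Set.univ := by
  intro p
  have growth : ∀ k, influence G p (T * k) = Set.univ ∨ k + 1 ≤ (influence G p (T * k)).ncard := by
    intro k
    induction k with
    | zero => simp [influence]
    | succ k ih =>
      by_cases hfull : influence G p (T * k) = Set.univ
      · exact Or.inl (Set.univ_subset_iff.1
          (hfull ▸ influence_mono G p (Nat.mul_le_mul_left T k.le_succ)))
      · have hlt := Set.ncard_lt_ncard
          (influence_ssubset_add (hconn (T * k + 1) (Nat.le_add_left 1 _)) hfull)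
        rw [← Nat.mul_succ] at hlt
        exact Or.inr ((ih.resolve_left hfull).trans_lt hlt)
  refine (growth (n - 1)).elim id fun hcount => ?_
  rw [Nat.sub_add_cancel hn] at hcount
  refine Set.eq_of_subset_of_ncard_le (Set.subset_univ _) ?_
  rwa [Set.ncard_univ, Nat.card_eq_fintype_card, hcard]
end

section
/- Let V, r, par be a finite rooted tree and let a be an integer weight function on it with a(r) = n. Then the number of branching nodes of the tree is at most n − 1. -/
/-- Summing a function over the children of every node counts each non-root node once. -/
theorem sum_sum_children_eq {V M : Type*} [Fintype V] [DecidableEq V] [AddCommMonoid M]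
    (r : V) (par : V → V) (f : V → M) :
    ∑ v, ∑ u ∈ Finset.univ.filter (fun u => u ≠ r ∧ par u = v), f u =
      ∑ u ∈ Finset.univ.erase r, f u := by
  rw [← Finset.sum_fiberwise (Finset.univ.erase r) par f]
  refine Finset.sum_congr rfl fun v _ => Finset.sum_congr ?_ fun _ _ => rfl
  ext u
  simp

/-- A history tree whose root has anonymity `n` contains at most `n - 1` branching nodes. -/
theorem branching_nodes_le
    {V : Type*} [Fintype V] [DecidableEq V]
    (r : V) (par : V → V) (hroot : par r = r)
    (htree : ∀ v : V, ∃ k : ℕ, par^[k] v = r)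
    (a : V → ℤ) (n : ℤ)
    (ha : ∀ v, 1 ≤ a v)
    (hsum : ∀ v : V,
      (∑ u ∈ Finset.univ.filter (fun u => u ≠ r ∧ par u = v), a u) ≤ a v)
    (har : a r = n) :
    ((Finset.univ.filter (fun v : V =>
        2 ≤ (Finset.univ.filter (fun u => u ≠ r ∧ par u = v)).card)).card : ℤ)
      ≤ n - 1 := by
  have total : ∑ v, ((a v - 1) -
      ∑ u ∈ Finset.univ.filter (fun u => u ≠ r ∧ par u = v), (a u - 1)) = n - 1 := by
    rw [Finset.sum_sub_distrib, sum_sum_children_eq, Finset.sum_erase_eq_sub (Finset.mem_univ r),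
      har]
    ring
  rw [← total, Finset.card_filter, Nat.cast_sum]
  refine Finset.sum_le_sum fun v _ => ?_
  have hv := hsum v
  have hone := ha v
  rw [Finset.sum_sub_distrib, Finset.sum_const, nsmul_eq_mul, mul_one]
  split_ifs with h
  · push_cast
    omega
  · rcases Nat.eq_zero_or_pos
      (Finset.univ.filter (fun u => u ≠ r ∧ par u = v)).card with h0 | h0
    · rw [h0, Finset.card_eq_zero.mp h0, Finset.sum_empty]
      push_cast
      omega
    · push_cast
      omega
end

section
/- Let V, r, par be a finite rooted tree, let a be an integer weight function on it with a(r) = n ≥ 1, let T ≥ 1 be an integer, and suppose that every node of depth strictly less than Tn has at least one child. Then there exists an integer s with 0 ≤ s and s + T ≤ Tn such that every node whose depth lies in {s, s+1, …, s+T−1} has exactly one child. -/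
open Finset in
/-- Summing over the nodes of depth `d + 1` amounts to summing over the children of the nodes of
depth `d`. -/
lemma sum_succ_level_eq_sum_children {V M : Type*} [Fintype V] [DecidableEq V] [AddCommMonoid M]
    {r : V} {par : V → V} {depth : V → ℕ} (hr : depth r = 0)
    (hdepth : ∀ u, u ≠ r → depth u = depth (par u) + 1) (f : V → M) (d : ℕ) :
    ∑ u ∈ univ.filter (fun u => depth u = d + 1), f u =
      ∑ v ∈ univ.filter (fun v => depth v = d),
        ∑ u ∈ univ.filter (fun u => u ≠ r ∧ par u = v), f u := by
  have hne : ∀ u, depth u = d + 1 → u ≠ r := by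
    rintro u hu rfl
    omega
  rw [← sum_fiberwise_of_maps_to (t := univ.filter (fun v => depth v = d)) (g := par)]
  · refine sum_congr rfl fun v hv => sum_congr ?_ fun _ _ => rfl
    ext u
    simp only [mem_filter, mem_univ, true_and] at hv ⊢
    constructor
    · rintro ⟨h, rfl⟩
      exact ⟨hne u h, rfl⟩
    · rintro ⟨h, rfl⟩
      exact ⟨by rw [hdepth u h, hv], rfl⟩
  · intro u hu
    simp only [mem_filter, mem_univ, true_and] at hu ⊢
    have := hdepth u (hne u hu)
    omega

/-- The least number of iterations reaching `r` grows by one from a parent to its child. -/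
lemma sInf_iterate_eq_succ {V : Type*} {r : V} {par : V → V}
    (htree : ∀ v : V, ∃ k : ℕ, par^[k] v = r) {u : V} (hu : u ≠ r) :
    sInf {k : ℕ | par^[k] u = r} = sInf {k : ℕ | par^[k] (par u) = r} + 1 := by
  have hmem : par^[sInf {k : ℕ | par^[k] (par u) = r}] (par u) = r := Nat.sInf_mem (htree (par u))
  have hmem' : par^[sInf {k : ℕ | par^[k] u = r}] u = r := Nat.sInf_mem (htree u)
  apply le_antisymm
  · exact Nat.sInf_le hmem
  · cases hk : sInf {k : ℕ | par^[k] u = r} with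
    | zero =>
      rw [hk] at hmem'
      exact absurd hmem' hu
    | succ k =>
      rw [hk] at hmem'
      exact Nat.succ_le_succ (Nat.sInf_le hmem')

/-- The first `T*n` levels of a history tree with root anonymity `n` contain `T`
consecutive levels all of whose nodes are non-branching (have exactly one child). -/
theorem exists_T_nonbranching_levels
    {V : Type*} [Fintype V] [DecidableEq V]
    (r : V) (par : V → V) (hroot : par r = r)
    (htree : ∀ v : V, ∃ k : ℕ, par^[k] v = r)
    (a : V → ℤ)
    (ha : ∀ v, 1 ≤ a v)
    (hsum : ∀ v : V,
      (∑ u ∈ Finset.univ.filter (fun u => u ≠ r ∧ par u = v), a u) ≤ a v)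
    (n T : ℕ) (hn : 1 ≤ n) (hT : 1 ≤ T)
    (har : a r = (n : ℤ))
    (hchild : ∀ v : V, sInf {k : ℕ | par^[k] v = r} < T * n →
      ∃ u : V, u ≠ r ∧ par u = v) :
    ∃ s : ℕ, s + T ≤ T * n ∧
      ∀ v : V, s ≤ sInf {k : ℕ | par^[k] v = r} →
        sInf {k : ℕ | par^[k] v = r} < s + T →
        (Finset.univ.filter (fun u => u ≠ r ∧ par u = v)).card = 1 := by
  set depth : V → ℕ := fun v => sInf {k : ℕ | par^[k] v = r}
  have hr : depth r = 0 := Nat.le_zero.1 (Nat.sInf_le rfl)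
  have hdepth : ∀ u, u ≠ r → depth u = depth (par u) + 1 := fun u hu =>
    sInf_iterate_eq_succ htree hu
  have hzero : Finset.univ.filter (fun v => depth v = 0) = {r} := by
    ext v
    simp only [Finset.mem_filter, Finset.mem_univ, true_and, Finset.mem_singleton]
    constructor
    · intro h
      by_contra hv
      have := hdepth v hv
      omega
    · rintro rfl
      exact hr
  have hweight : ∀ d, ∑ v ∈ Finset.univ.filter (fun v => depth v = d), a v ≤ n := by
    intro d
    induction d with
    | zero => simp [hzero, har]
    | succ d ih =>
      rw [sum_succ_level_eq_sum_children hr hdepth]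
      exact (Finset.sum_le_sum fun v _ => hsum v).trans ih
  have hcard : ∀ d, (Finset.univ.filter (fun v => depth v = d)).card ≤ n := by
    intro d
    have h := Finset.card_nsmul_le_sum (Finset.univ.filter (fun v => depth v = d)) a 1
      fun v _ => ha v
    rw [nsmul_eq_mul, mul_one] at h
    exact_mod_cast h.trans (hweight d)
  have hcard_succ : ∀ d, (Finset.univ.filter (fun v => depth v = d + 1)).card =
      ∑ v ∈ Finset.univ.filter (fun v => depth v = d),
        (Finset.univ.filter (fun u => u ≠ r ∧ par u = v)).card := by
    intro d
    simpa only [Finset.card_eq_sum_ones] using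
      sum_succ_level_eq_sum_children hr hdepth (fun _ => 1) d
  have hpos : ∀ v, depth v < T * n →
      1 ≤ (Finset.univ.filter (fun u => u ≠ r ∧ par u = v)).card := by
    intro v hv
    obtain ⟨u, hu⟩ := hchild v hv
    exact Finset.card_pos.2 ⟨u, by simpa using hu⟩
  have hstep : ∀ d, d < T * n → (Finset.univ.filter (fun v => depth v = d)).card ≤
      (Finset.univ.filter (fun v => depth v = d + 1)).card := by
    intro d hd
    rw [hcard_succ, Finset.card_eq_sum_ones]
    refine Finset.sum_le_sum fun v hv => hpos v ?_
    rw [(Finset.mem_filter.1 hv).2]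
    exact hd
  have hmono : ∀ d e, d ≤ e → e ≤ T * n → (Finset.univ.filter (fun v => depth v = d)).card ≤
      (Finset.univ.filter (fun v => depth v = e)).card := by
    intro d e hde
    induction e, hde using Nat.le_induction with
    | base => exact fun _ => le_rfl
    | succ e _ ih => exact fun he => (ih (by omega)).trans (hstep e (by omega))
  have hstrict : ∀ v, depth v < T * n →
      (Finset.univ.filter (fun u => u ≠ r ∧ par u = v)).card ≠ 1 →
      (Finset.univ.filter (fun w => depth w = depth v)).card <
        (Finset.univ.filter (fun w => depth w = depth v + 1)).card := by
    intro v hv hne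
    rw [hcard_succ, Finset.card_eq_sum_ones]
    refine Finset.sum_lt_sum (fun w hw => hpos w ?_) ⟨v, by simp, ?_⟩
    · rw [(Finset.mem_filter.1 hw).2]
      exact hv
    · exact lt_of_le_of_ne (hpos v hv) hne.symm
  by_contra! hcon
  have hgrow : ∀ i, i ≤ n →
      i + 1 ≤ (Finset.univ.filter (fun v => depth v = T * i)).card := by
    intro i
    induction i with
    | zero => simp [hzero]
    | succ i ih =>
      intro hi
      have hle : T * i + T ≤ T * n := Nat.mul_le_mul_left T hi
      obtain ⟨v, hv, hv', hne⟩ := hcon (T * i) hle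
      change T * i ≤ depth v at hv
      change depth v < T * i + T at hv'
      have h₀ := ih (by omega)
      have h₁ := hmono (T * i) (depth v) hv (by omega)
      have h₂ := hstrict v (by omega) hne
      have h₃ := hmono (depth v + 1) (T * i + T) (by omega) hle
      rw [Nat.mul_succ]
      omega
  have := hgrow n le_rfl
  have := hcard (T * n)
  omega
end

section
/- Let V, r, par be a finite rooted tree, let a be an integer weight function on it, and fix marked nodes M ⊆ V and guesses g : V → ℤ satisfying conditions (i)–(iii) of a well-spread guess assignment. If a node v is heavy and no strict descendant of v is heavy, then g(v) = a(v). -/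
open scoped Classical

/-- The depth of a non-root node exceeds that of its parent by one. -/
theorem sInf_iterate_eq_root_of_ne {V : Type*} {r : V} {par : V → V}
    (htree : ∀ v : V, ∃ k : ℕ, par^[k] v = r) {x : V} (hx : x ≠ r) :
    sInf {k : ℕ | par^[k] x = r} = sInf {k : ℕ | par^[k] (par x) = r} + 1 := by
  have hmem : par^[sInf {k : ℕ | par^[k] x = r}] x = r :=
    Nat.sInf_mem (s := {k : ℕ | par^[k] x = r}) (htree x)
  have hmem_par : par^[sInf {k : ℕ | par^[k] (par x) = r}] (par x) = r :=
    Nat.sInf_mem (s := {k : ℕ | par^[k] (par x) = r}) (htree (par x))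
  refine le_antisymm (Nat.sInf_le hmem_par) ?_
  generalize sInf {k : ℕ | par^[k] x = r} = d at hmem
  cases d with
  | zero => exact absurd hmem hx
  | succ d => exact Nat.succ_le_succ (Nat.sInf_le hmem)

/-- An ancestor is no deeper than its descendants. -/
theorem sInf_iterate_eq_root_le {V : Type*} {r : V} {par : V → V} (hroot : par r = r)
    (htree : ∀ v : V, ∃ k : ℕ, par^[k] v = r) (k : ℕ) (x : V) :
    sInf {j : ℕ | par^[j] (par^[k] x) = r} ≤ sInf {j : ℕ | par^[j] x = r} := by
  induction k generalizing x with
  | zero => exact le_rfl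
  | succ k ih =>
    refine (ih (par x)).trans ?_
    by_cases hx : x = r
    · rw [hx, hroot]
    · rw [sInf_iterate_eq_root_of_ne htree hx]
      exact Nat.le_succ _

/-- A strict descendant of `u` descends from a child of `u`. -/
theorem exists_child_of_iterate_eq {V : Type*} {r : V} {par : V → V} (hroot : par r = r)
    {k : ℕ} {x u : V} (h : par^[k] x = u) (hne : x ≠ u) :
    ∃ c, (c ≠ r ∧ par c = u) ∧ ∃ j : ℕ, par^[j] x = c := by
  induction k with
  | zero => exact absurd h hne
  | succ k ih =>
    by_cases hk : par^[k] x = u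
    · exact ih hk
    · rw [Function.iterate_succ_apply'] at h
      refine ⟨par^[k] x, ⟨fun hr => hk ?_, h⟩, k, rfl⟩
      rw [← h, hr, hroot]

/-- The marked strict descendants of a node are covered by the marked descendants
of its children. -/
theorem card_strict_descendants_le_sum {V : Type*} [Fintype V] {r : V} {par : V → V}
    (hroot : par r = r) (M : Finset V) (u : V) :
    (M.filter (fun x => x ≠ u ∧ ∃ k : ℕ, par^[k] x = u)).card ≤
      ∑ c ∈ Finset.univ.filter (fun c => c ≠ r ∧ par c = u),
        (M.filter (fun x => ∃ k : ℕ, par^[k] x = c)).card := by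
  refine le_trans (Finset.card_le_card fun x hx => ?_) Finset.card_biUnion_le
  simp only [Finset.mem_filter, Finset.mem_biUnion, Finset.mem_univ, true_and] at hx ⊢
  obtain ⟨hxM, hne, k, hk⟩ := hx
  obtain ⟨c, hc, hj⟩ := exists_child_of_iterate_eq hroot hk hne
  exact ⟨c, hc, hxM, hj⟩

/-- The marked descendants of `u` are its marked strict descendants and, if marked,
`u` itself. -/
theorem card_descendants_eq {V : Type*} (par : V → V) (M : Finset V) (u : V) :
    (M.filter (fun x => ∃ k : ℕ, par^[k] x = u)).card =
      (M.filter (fun x => x ≠ u ∧ ∃ k : ℕ, par^[k] x = u)).card + if u ∈ M then 1 else 0 := by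
  have hself : M.filter (fun x => x = u) = if u ∈ M then {u} else ∅ := Finset.filter_eq' M u
  have hcard : (M.filter (fun x => x = u)).card = if u ∈ M then 1 else 0 := by
    rw [hself]; split_ifs <;> simp
  rw [← hcard, ← Finset.card_union_of_disjoint]
  · congr 1
    ext x
    simp only [Finset.mem_filter, Finset.mem_union]
    constructor
    · rintro ⟨hM, hk⟩
      by_cases hx : x = u
      · exact Or.inr ⟨hM, hx⟩
      · exact Or.inl ⟨hM, hx, hk⟩
    · rintro (⟨hM, -, hk⟩ | ⟨hM, hx⟩)
      · exact ⟨hM, hk⟩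
      · exact ⟨hM, 0, hx⟩
  · exact Finset.disjoint_filter.2 fun x _ h hx => h.1 hx

/-- If no strict descendant of `u` is heavy, then `u` has fewer than `a u` marked strict
descendants. -/
theorem card_strict_descendants_lt {V : Type*} [Fintype V]
    {r : V} {par : V → V} (hroot : par r = r)
    (htree : ∀ v : V, ∃ k : ℕ, par^[k] v = r)
    {a : V → ℤ}
    (ha : ∀ v, 1 ≤ a v)
    (hsum : ∀ v : V,
      (∑ u ∈ Finset.univ.filter (fun u => u ≠ r ∧ par u = v), a u) ≤ a v)
    {M : Finset V} {g : V → ℤ}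
    (honly : ∀ v ∈ M, v ≠ r → (∀ u : V, u ≠ r → par u = par v → u = v) → g v = a v)
    (hspread : ∀ u ∈ M, ∀ v ∈ M,
      sInf {k : ℕ | par^[k] u = r} = sInf {k : ℕ | par^[k] v = r} → u = v)
    (u : V)
    (hnone : ∀ v' : V, v' ≠ u → (∃ k : ℕ, par^[k] v' = u) → v' ∈ M →
      ¬ (g v' ≤ ((M.filter (fun x => ∃ k : ℕ, par^[k] x = v')).card : ℤ))) :
    ((M.filter (fun x => x ≠ u ∧ ∃ k : ℕ, par^[k] x = u)).card : ℤ) < a u := by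
  let depth : V → ℕ := fun x => sInf {k : ℕ | par^[k] x = r}
  have hwf : WellFounded (fun x y : V => depth y < depth x) :=
    have : IsTrans V (fun x y : V => depth y < depth x) := ⟨fun _ _ _ h h' => h'.trans h⟩
    have : Std.Irrefl (fun x y : V => depth y < depth x) := ⟨fun _ => lt_irrefl _⟩
    Finite.wellFounded_of_trans_of_irrefl _
  induction u using hwf.induction with
  | h u ih =>
  set C := Finset.univ.filter (fun c => c ≠ r ∧ par c = u) with hC
  have hmemC : ∀ c, c ∈ C ↔ c ≠ r ∧ par c = u := fun c => by simp [hC]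
  have hdepth : ∀ c ∈ C, depth c = depth u + 1 := by
    intro c hc
    obtain ⟨hcr, hcu⟩ := (hmemC c).1 hc
    rw [← hcu]
    exact sInf_iterate_eq_root_of_ne htree hcr
  have hne_of_desc : ∀ c ∈ C, ∀ x, (∃ k : ℕ, par^[k] x = c) → x ≠ u := by
    rintro c hc x ⟨k, hk⟩ rfl
    have hle : depth c ≤ depth x := hk ▸ sInf_iterate_eq_root_le hroot htree k x
    have := hdepth c hc
    omega
  have hdesc : ∀ c ∈ C, ∀ x, (∃ k : ℕ, par^[k] x = c) → ∃ k : ℕ, par^[k] x = u := by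
    rintro c hc x ⟨k, hk⟩
    exact ⟨k + 1, by rw [Function.iterate_succ_apply', hk, ((hmemC c).1 hc).2]⟩
  have hchild : ∀ c ∈ C,
      ((M.filter (fun x => x ≠ c ∧ ∃ k : ℕ, par^[k] x = c)).card : ℤ) < a c := fun c hc =>
    ih c (by rw [hdepth c hc]; exact Nat.lt_succ_self _) fun x _ hx =>
      hnone x (hne_of_desc c hc x hx) (hdesc c hc x hx)
  have hcover : ((M.filter (fun x => x ≠ u ∧ ∃ k : ℕ, par^[k] x = u)).card : ℤ) ≤
      ∑ c ∈ C, ((M.filter (fun x => ∃ k : ℕ, par^[k] x = c)).card : ℤ) := by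
    exact_mod_cast card_strict_descendants_le_sum hroot M u
  have hau := hsum u
  rw [← hC] at hau
  rcases lt_trichotomy C.card 1 with hcard | hcard | hcard
  · have hempty : C = ∅ := Finset.card_eq_zero.1 (by omega)
    rw [hempty, Finset.sum_empty] at hcover
    linarith [ha u]
  · obtain ⟨c, hc⟩ := Finset.card_eq_one.1 hcard
    have hcC : c ∈ C := by simp [hc]
    rw [hc, Finset.sum_singleton] at hcover hau
    suffices hlt : ((M.filter (fun x => ∃ k : ℕ, par^[k] x = c)).card : ℤ) < a c by linarith
    by_cases hcM : c ∈ M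
    · obtain ⟨hcr, hcu⟩ := (hmemC c).1 hcC
      have hexact : g c = a c := honly c hcM hcr fun x hxr hxc =>
        Finset.mem_singleton.1 (hc ▸ (hmemC x).2 ⟨hxr, hxc.trans hcu⟩)
      rw [← hexact]
      exact not_le.1 (hnone c (hne_of_desc c hcC c ⟨0, rfl⟩) (hdesc c hcC c ⟨0, rfl⟩) hcM)
    · rw [card_descendants_eq, if_neg hcM, add_zero]
      exact hchild c hcC
  · have hmarked : (∑ c ∈ C, if c ∈ M then (1 : ℤ) else 0) ≤ 1 := by
      rw [Finset.sum_boole]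
      refine mod_cast Finset.card_le_one.2 fun x hx y hy => ?_
      rw [Finset.mem_filter] at hx hy
      exact hspread x hx.2 y hy.2 ((hdepth x hx.1).trans (hdepth y hy.1).symm)
    have hbound : ∑ c ∈ C, ((M.filter (fun x => ∃ k : ℕ, par^[k] x = c)).card : ℤ) ≤
        ∑ c ∈ C, (a c - 1 + if c ∈ M then (1 : ℤ) else 0) := by
      refine Finset.sum_le_sum fun c hc => ?_
      rw [card_descendants_eq]
      push_cast
      linarith [Int.le_sub_one_of_lt (hchild c hc)]
    rw [Finset.sum_add_distrib, Finset.sum_sub_distrib, Finset.sum_const, nsmul_eq_mul,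
      mul_one] at hbound
    have : (1 : ℤ) < C.card := mod_cast hcard
    linarith

/-- Lemma C.3 (xl:crit): in a well-spread assignment of guesses, if a node `v` is heavy
and no strict descendant of `v` is heavy, then the guess at `v` is correct. -/
theorem heavy_without_heavy_descendants_correct
    {V : Type*} [Fintype V]
    (r : V) (par : V → V) (hroot : par r = r)
    (htree : ∀ v : V, ∃ k : ℕ, par^[k] v = r)
    (a : V → ℤ)
    (ha : ∀ v, 1 ≤ a v)
    (hsum : ∀ v : V,
      (∑ u ∈ Finset.univ.filter (fun u => u ≠ r ∧ par u = v), a u) ≤ a v)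
    (M : Finset V) (g : V → ℤ)
    -- (i) guesses never underestimate
    (hge : ∀ v ∈ M, a v ≤ g v)
    -- (ii) guesses are exact on only children
    (honly : ∀ v ∈ M, v ≠ r → (∀ u : V, u ≠ r → par u = par v → u = v) → g v = a v)
    -- (iii) well-spread: distinct marked nodes have distinct depths
    (hspread : ∀ u ∈ M, ∀ v ∈ M,
      sInf {k : ℕ | par^[k] u = r} = sInf {k : ℕ | par^[k] v = r} → u = v)
    (v : V)
    -- `v` is heavy
    (hvM : v ∈ M)
    (hheavy : g v ≤ ((M.filter (fun u => ∃ k : ℕ, par^[k] u = v)).card : ℤ))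
    -- no strict descendant of `v` is heavy
    (hnone : ∀ v' : V, v' ≠ v → (∃ k : ℕ, par^[k] v' = v) → v' ∈ M →
      ¬ (g v' ≤ ((M.filter (fun u => ∃ k : ℕ, par^[k] u = v')).card : ℤ))) :
    g v = a v := by
  have hlt := card_strict_descendants_lt hroot htree ha hsum honly hspread v hnone
  rw [card_descendants_eq, if_pos hvM] at hheavy
  push_cast at hheavy
  linarith [hge v hvM, Int.add_one_le_of_lt hlt]
end

section
/- Let V, r, par be a finite rooted tree, let a : V → ℚ be a map with a(v) > 0 for all v and such that for every node v, a(v) is at least the sum of a(u) over all children u of v, and let M ⊆ V be any subset. For v ∈ V let w(v) denote the number of nodes of M that are descendants of v. Then for every node v with w(v) > a(v), there exists a node v' ∈ M that is a descendant of v and satisfies w(v') > a(v'). -/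
open scoped Classical

/-- A strict descendant of `v` is a descendant of a child of `v`. -/
lemma exists_child_iterate_eq {V : Type*} {r : V} {par : V → V} (hroot : par r = r)
    {m v : V} (hmv : m ≠ v) (h : ∃ k : ℕ, par^[k] m = v) :
    ∃ u, (u ≠ r ∧ par u = v) ∧ ∃ k : ℕ, par^[k] m = u := by
  obtain ⟨k, hk, hmin⟩ : ∃ k, par^[k] m = v ∧ ∀ j < k, par^[j] m ≠ v :=
    ⟨Nat.find h, Nat.find_spec h, fun j hj => Nat.find_min h hj⟩
  cases k with
  | zero => exact absurd hk hmv
  | succ k =>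
    rw [Function.iterate_succ_apply'] at hk
    refine ⟨par^[k] m, ⟨fun hr => hmin k k.lt_succ_self ?_, hk⟩, k, rfl⟩
    rw [← hk, hr, hroot]

/-- If `v` is unmarked and its subtree contains more than `a v` marked nodes, then so does the
subtree of some child, relative to the weight of that child. -/
lemma exists_overloaded_child {V : Type*} [Fintype V] {r : V} {par : V → V}
    (hroot : par r = r) {a : V → ℚ} {M : Finset V} {v : V}
    (hsum : (∑ u ∈ Finset.univ.filter (fun u => u ≠ r ∧ par u = v), a u) ≤ a v)
    (hv : v ∉ M)
    (hov : a v < ((M.filter (fun u => ∃ k : ℕ, par^[k] u = v)).card : ℚ)) :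
    ∃ u, (u ≠ r ∧ par u = v) ∧
      a u < ((M.filter (fun m => ∃ k : ℕ, par^[k] m = u)).card : ℚ) := by
  by_contra! hcon
  have hsub : M.filter (fun u => ∃ k : ℕ, par^[k] u = v) ⊆
      (Finset.univ.filter (fun u => u ≠ r ∧ par u = v)).biUnion
        (fun u => M.filter (fun m => ∃ k : ℕ, par^[k] m = u)) := by
    intro m hm
    rw [Finset.mem_filter] at hm
    obtain ⟨u, hu, hk⟩ := exists_child_iterate_eq hroot (ne_of_mem_of_not_mem hm.1 hv) hm.2
    exact Finset.mem_biUnion.2 ⟨u, Finset.mem_filter.2 ⟨Finset.mem_univ u, hu⟩,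
      Finset.mem_filter.2 ⟨hm.1, hk⟩⟩
  have hcard := (Finset.card_le_card hsub).trans Finset.card_biUnion_le
  refine hov.not_ge (le_trans ?_ hsum)
  calc ((M.filter (fun u => ∃ k : ℕ, par^[k] u = v)).card : ℚ)
      ≤ ∑ u ∈ Finset.univ.filter (fun u => u ≠ r ∧ par u = v),
          ((M.filter (fun m => ∃ k : ℕ, par^[k] m = u)).card : ℚ) := mod_cast hcard
    _ ≤ _ := Finset.sum_le_sum fun u hu => hcon u (Finset.mem_filter.1 hu).2

/-- Counting claim inside Lemma C.4 (xl:bound1): if the subtree hanging from `v`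
contains more than `a v` marked nodes, then it contains a marked node `v'` whose
hanging subtree contains more than `a v'` marked nodes. -/
theorem exists_overloaded_marked_descendant
    {V : Type*} [Fintype V]
    (r : V) (par : V → V) (hroot : par r = r)
    (htree : ∀ v : V, ∃ k : ℕ, par^[k] v = r)
    (a : V → ℚ)
    (ha : ∀ v, 0 < a v)
    (hsum : ∀ v : V,
      (∑ u ∈ Finset.univ.filter (fun u => u ≠ r ∧ par u = v), a u) ≤ a v)
    (M : Finset V) :
    ∀ v : V,
      a v < ((M.filter (fun u => ∃ k : ℕ, par^[k] u = v)).card : ℚ) →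
      ∃ v' ∈ M, (∃ k : ℕ, par^[k] v' = v) ∧
        a v' < ((M.filter (fun u => ∃ k : ℕ, par^[k] u = v')).card : ℚ) := by
  intro v hv
  by_contra! hcon
  choose d hd using htree
  have hchain : ∀ n : ℕ, ∃ u, (∃ k : ℕ, par^[k] u = v) ∧
      a u < ((M.filter (fun m => ∃ k : ℕ, par^[k] m = u)).card : ℚ) ∧
      ∀ j < n, par^[j] u ≠ r := by
    intro n
    induction n with
    | zero => exact ⟨v, ⟨0, rfl⟩, hv, fun j hj => absurd hj j.not_lt_zero⟩
    | succ n ih =>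
      obtain ⟨u, ⟨k, hk⟩, hov, hne⟩ := ih
      have huM : u ∉ M := fun hu => (hcon u hu ⟨k, hk⟩).not_gt hov
      obtain ⟨c, ⟨hcr, hcu⟩, hc⟩ := exists_overloaded_child hroot (hsum u) huM hov
      refine ⟨c, ⟨k + 1, by rw [Function.iterate_succ_apply, hcu, hk]⟩, hc, fun j hj => ?_⟩
      cases j with
      | zero => exact hcr
      | succ j =>
        rw [Function.iterate_succ_apply, hcu]
        exact hne j (Nat.lt_of_succ_lt_succ hj)
  obtain ⟨u, -, -, hne⟩ := hchain (Finset.univ.sup d + 1)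
  exact hne (d u) (Nat.lt_succ_of_le (Finset.le_sup (Finset.mem_univ u))) (hd u)
end
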